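/- For every integer n ≥ 1, every t ≥ 0 with (1-q^n)·t < 1, every x ≥ 0 and all parameters α, β ≥ 0, writing y = [n]_q·t, R_{n,t} = e_q^{q·y}·E_q^{-y}/A(1) and R'_{n,t} = e_q^{q²·y}·E_q^{-y}/A(1), the operator applied to e₂(s) = s² satisfies T_{n,t}^{α,β}(e₂;q;x) = x² + 2x·(α + y + R_{n,t}·D_qA(1))/([n]_q+β) + (α² + 2α·(y + R_{n,t}·D_qA(1)) + q·y² + y + 2q·y·R_{n,t}·D_qA(1) + (q·D_q²A(1) + D_qA(1))·R'_{n,t})/([n]_q+β)². -/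

import Mathlib

open Filter

/-- The `q`-integer `[n]_q = (1 - q^n)/(1 - q)`. -/
noncomputable def qInt (q : ℝ) (n : ℕ) : ℝ := (1 - q ^ n) / (1 - q)

/-- The `q`-factorial `[n]_q! = [1]_q [2]_q ⋯ [n]_q`, with `[0]_q! = 1`. -/
noncomputable def qFact (q : ℝ) (n : ℕ) : ℝ := ∏ i ∈ Finset.range n, qInt q (i + 1)

/-- The `q`-exponential `e_q^x = ∑ x^n/[n]_q!`. -/
noncomputable def qExp (q x : ℝ) : ℝ := ∑' n : ℕ, x ^ n / qFact q n

/-- The `q`-exponential `E_q^x = ∑ q^{n(n-1)/2} x^n/[n]_q!`. -/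
noncomputable def qExpE (q x : ℝ) : ℝ := ∑' n : ℕ, q ^ (n * (n - 1) / 2) * x ^ n / qFact q n

/-- The power series `A(u) = ∑ c_k u^k`. -/
noncomputable def APow (c : ℕ → ℝ) (u : ℝ) : ℝ := ∑' k : ℕ, c k * u ^ k

/-- The `q`-Appell polynomial `P_k(q;y) = [k]_q! ∑_{j=0}^k c_j y^{k-j}/[k-j]_q!`. -/
noncomputable def qAppell (c : ℕ → ℝ) (q y : ℝ) (k : ℕ) : ℝ :=
  qFact q k * ∑ j ∈ Finset.range (k + 1), c j * y ^ (k - j) / qFact q (k - j)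

/-- `D_q A(1) = (A(1) - A(q))/(1-q)`. -/
noncomputable def DqA1 (c : ℕ → ℝ) (q : ℝ) : ℝ := (APow c 1 - APow c q) / (1 - q)

/-- `D_q A(q) = (A(q) - A(q²))/((1-q) q)`. -/
noncomputable def DqAq (c : ℕ → ℝ) (q : ℝ) : ℝ := (APow c q - APow c (q ^ 2)) / ((1 - q) * q)

/-- `D_q² A(1) = (D_q A(1) - D_q A(q))/(1-q)`. -/
noncomputable def Dq2A1 (c : ℕ → ℝ) (q : ℝ) : ℝ := (DqA1 c q - DqAq c q) / (1 - q)

/-- The Stancu-type `q`-Favard–Szász operator `T_{n,t}^{α,β}(f;q;x)`. -/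
noncomputable def Tq (c : ℕ → ℝ) (q : ℝ) (n : ℕ) (t α β : ℝ) (f : ℝ → ℝ) (x : ℝ) : ℝ :=
  qExpE q (-(qInt q n * t)) / APow c 1 *
    ∑' k : ℕ, qAppell c q (qInt q n * t) k / qFact q k *
      f (x + (qInt q k + α) / (qInt q n + β))

/-- Statistical convergence of a real sequence to `l`. -/
def StatLim (x : ℕ → ℝ) (l : ℝ) : Prop :=
  ∀ ε > 0, Tendsto
    (fun n : ℕ => (((Finset.Icc 1 n).filter fun k => ε ≤ |x k - l|).card : ℝ) / n)
    atTop (nhds 0)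

/-- Modulus of continuity of `f` on `[0,∞)`. -/
noncomputable def modCont (f : ℝ → ℝ) (δ : ℝ) : ℝ :=
  sSup {r : ℝ | ∃ u v : ℝ, 0 ≤ u ∧ 0 ≤ v ∧ |u - v| ≤ δ ∧ r = |f u - f v|}

/-- Second-order modulus of smoothness of `f` on `[0,∞)`. -/
noncomputable def mod2 (f : ℝ → ℝ) (δ : ℝ) : ℝ :=
  sSup {r : ℝ | ∃ h x : ℝ, 0 < h ∧ h ≤ δ ∧ 0 ≤ x ∧
    r = |f (x + 2 * h) - 2 * f (x + h) + f x|}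

theorem qInt_pos' {q : ℝ} (hq0 : 0 < q) (hq1 : q < 1) (k : ℕ) : 0 < qInt q (k + 1) := by
  unfold qInt
  have : q ^ (k + 1) < 1 := pow_lt_one₀ hq0.le hq1 (Nat.succ_ne_zero k)
  exact div_pos (by linarith) (by linarith)

theorem qFact_pos' {q : ℝ} (hq0 : 0 < q) (hq1 : q < 1) (k : ℕ) : 0 < qFact q k :=
  Finset.prod_pos fun i _ => qInt_pos' hq0 hq1 i

theorem qFact_succ' (q : ℝ) (k : ℕ) : qFact q (k + 1) = qFact q k * qInt q (k + 1) := by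
  unfold qFact
  rw [Finset.prod_range_succ]

theorem summable_e {q : ℝ} (hq0 : 0 < q) (hq1 : q < 1) {z : ℝ} (hz0 : 0 ≤ z)
    (hz : (1 - q) * z < 1) : Summable fun k : ℕ => z ^ k / qFact q k := by
  rcases hz0.eq_or_lt with rfl | hz0
  · apply summable_of_ne_finset_zero (s := {0})
    intro b hb
    have : b ≠ 0 := by simpa using hb
    simp [this]
  have hq : (1 - q) ≠ 0 := by linarith
  apply summable_of_ratio_test_tendsto_lt_one (l := (1 - q) * z) hz
  · filter_upwards with k
    exact (div_pos (pow_pos hz0 k) (qFact_pos' hq0 hq1 k)).ne'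
  · have h1 : Tendsto (fun k : ℕ => (1 - q) * z / (1 - q ^ (k + 1))) atTop
        (nhds ((1 - q) * z / (1 - 0))) := by
      apply Tendsto.div tendsto_const_nhds _ (by norm_num)
      exact tendsto_const_nhds.sub
        ((tendsto_pow_atTop_nhds_zero_of_lt_one hq0.le hq1).comp (tendsto_add_atTop_nat 1))
    simp only [sub_zero, div_one] at h1
    refine h1.congr fun k => ?_
    have hk := qInt_pos' hq0 hq1 k
    have hf := qFact_pos' hq0 hq1 k
    rw [Real.norm_of_nonneg (div_pos (pow_pos hz0 _) (qFact_pos' hq0 hq1 _)).le,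
      Real.norm_of_nonneg (div_pos (pow_pos hz0 _) (qFact_pos' hq0 hq1 _)).le, qFact_succ']
    have e : 1 - q ^ (k + 1) = (1 - q) * qInt q (k + 1) := by
      unfold qInt; field_simp
    rw [e, pow_succ]
    have := pow_pos hz0 k
    field_simp

theorem term_shift {q : ℝ} (hq0 : 0 < q) (hq1 : q < 1) (k : ℕ) :
    (1 - q ^ (k + 1)) / qFact q (k + 1) = (1 - q) / qFact q k := by
  have hk := qInt_pos' hq0 hq1 k
  have hf := qFact_pos' hq0 hq1 k
  have hq : (1 - q) ≠ 0 := by linarith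
  have e : 1 - q ^ (k + 1) = (1 - q) * qInt q (k + 1) := by
    unfold qInt; field_simp
  rw [e, qFact_succ']
  field_simp

theorem smaller {q : ℝ} (hq0 : 0 < q) (hq1 : q < 1) {z : ℝ} (hz0 : 0 ≤ z)
    (hz : (1 - q) * z < 1) : (1 - q) * (q * z) < 1 := by
  nlinarith [mul_nonneg (sub_pos.2 hq1).le (mul_nonneg (sub_pos.2 hq1).le hz0)]

theorem e_rec {q : ℝ} (hq0 : 0 < q) (hq1 : q < 1) {z : ℝ} (hz0 : 0 ≤ z)
    (hz : (1 - q) * z < 1) : qExp q (q * z) = qExp q z * (1 - (1 - q) * z) := by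
  have s1 := summable_e hq0 hq1 hz0 hz
  have s2 := summable_e hq0 hq1 (mul_nonneg hq0.le hz0) (smaller hq0 hq1 hz0 hz)
  have h : qExp q z - qExp q (q * z) = (1 - q) * z * qExp q z := by
    unfold qExp
    rw [← s1.tsum_sub s2, (s1.sub s2).tsum_eq_zero_add, ← tsum_mul_left]
    simp only [pow_zero, sub_self, zero_add]
    congr 1
    ext k
    have := term_shift hq0 hq1 k
    calc _ = z ^ (k + 1) * ((1 - q ^ (k + 1)) / qFact q (k + 1)) := by
          rw [mul_pow]; ring
      _ = _ := by rw [this]; ring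
  linarith

theorem E_bound {q : ℝ} (hq0 : 0 < q) (hq1 : q < 1) {z w : ℝ} (hz : |w| ≤ z) (k : ℕ) :
    ‖q ^ (k * (k - 1) / 2) * w ^ k / qFact q k‖ ≤ z ^ k / qFact q k := by
  have hf := qFact_pos' hq0 hq1 k
  rw [norm_div, Real.norm_of_nonneg hf.le, norm_mul, norm_pow, norm_pow, Real.norm_of_nonneg hq0.le]
  gcongr
  calc _ ≤ 1 * ‖w‖ ^ k := by
        gcongr
        exact pow_le_one₀ hq0.le hq1.le
    _ ≤ z ^ k := by
        rw [one_mul]; gcongr; exact hz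

theorem summable_E {q : ℝ} (hq0 : 0 < q) (hq1 : q < 1) {z w : ℝ} (hw : |w| ≤ z)
    (hz : (1 - q) * z < 1) :
    Summable fun k : ℕ => q ^ (k * (k - 1) / 2) * w ^ k / qFact q k :=
  Summable.of_norm_bounded (summable_e hq0 hq1 ((abs_nonneg w).trans hw) hz)
    (E_bound hq0 hq1 hw)

theorem E_rec {q : ℝ} (hq0 : 0 < q) (hq1 : q < 1) {z : ℝ} (hz0 : 0 ≤ z)
    (hz : (1 - q) * z < 1) :
    qExpE q (-z) = qExpE q (-(q * z)) * (1 - (1 - q) * z) := by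
  have s1 := summable_E hq0 hq1 (w := -z) (z := z) (by rw [abs_neg, abs_of_nonneg hz0]) hz
  have s2 := summable_E hq0 hq1 (w := -(q * z)) (z := z)
    (by rw [abs_neg, abs_of_nonneg (by positivity)]; nlinarith) hz
  have h : qExpE q (-z) - qExpE q (-(q * z)) = (1 - q) * (-z) * qExpE q (-(q * z)) := by
    unfold qExpE
    rw [← s1.tsum_sub s2, (s1.sub s2).tsum_eq_zero_add, ← tsum_mul_left]
    simp only [pow_zero, sub_self, zero_add]
    congr 1
    ext k
    have := term_shift hq0 hq1 k
    have e : (k + 1) * (k + 1 - 1) / 2 = k * (k - 1) / 2 + k := by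
      rw [← Finset.sum_range_id_mul_two, ← Finset.sum_range_id_mul_two]
      simp [Finset.sum_range_succ]
    rw [e, show -(q * z) = q * (-z) by ring]
    generalize -z = v
    calc _ = q ^ (k * (k - 1) / 2 + k) * v ^ (k + 1) *
            ((1 - q ^ (k + 1)) / qFact q (k + 1)) := by
          rw [mul_pow]; ring
      _ = _ := by rw [this]; ring
  linarith

theorem e_mul_E {q : ℝ} (hq0 : 0 < q) (hq1 : q < 1) {z : ℝ} (hz0 : 0 ≤ z)
    (hz : (1 - q) * z < 1) : qExp q z * qExpE q (-z) = 1 := by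
  have hle : ∀ m : ℕ, q ^ m * z ≤ z := fun m =>
    mul_le_of_le_one_left hz0 (pow_le_one₀ hq0.le hq1.le)
  have hn : ∀ m : ℕ, 0 ≤ q ^ m * z := fun m => by positivity
  have hz' : ∀ m : ℕ, (1 - q) * (q ^ m * z) < 1 := fun m =>
    lt_of_le_of_lt (mul_le_mul_of_nonneg_left (hle m) (by linarith)) hz
  have hinv : ∀ m : ℕ, qExp q (q ^ m * z) * qExpE q (-(q ^ m * z)) =
      qExp q z * qExpE q (-z) := by
    intro m
    induction m with
    | zero => simp
    | succ m ih =>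
      rw [← ih, E_rec hq0 hq1 (hn m) (hz' m), pow_succ', mul_assoc, e_rec hq0 hq1 (hn m) (hz' m)]
      ring
  have hs := summable_e hq0 hq1 hz0 hz
  have hlim : Tendsto (fun m : ℕ => q ^ m * z) atTop (nhds 0) := by
    simpa using (tendsto_pow_atTop_nhds_zero_of_lt_one hq0.le hq1).mul_const z
  have f0 : qFact q 0 = 1 := by simp [qFact]
  have e0 : qExp q 0 = 1 := by
    unfold qExp
    rw [tsum_eq_single 0]
    · simp [f0]
    · intro b hb; simp [hb]
  have E0 : qExpE q 0 = 1 := by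
    unfold qExpE
    rw [tsum_eq_single 0]
    · simp [f0]
    · intro b hb; simp [hb]
  have l1 : Tendsto (fun m : ℕ => qExp q (q ^ m * z)) atTop (nhds (qExp q 0)) := by
    unfold qExp
    apply tendsto_tsum_of_dominated_convergence hs
    · intro k
      exact (hlim.pow k).div_const _
    · filter_upwards with m k
      have hf := qFact_pos' hq0 hq1 k
      rw [Real.norm_of_nonneg (div_nonneg (pow_nonneg (hn m) k) hf.le)]
      have := hle m
      have := hn m
      gcongr
  have l2 : Tendsto (fun m : ℕ => qExpE q (-(q ^ m * z))) atTop (nhds (qExpE q (-0))) := by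
    unfold qExpE
    apply tendsto_tsum_of_dominated_convergence hs
    · intro k
      exact ((hlim.neg.pow k).const_mul _).div_const _
    · filter_upwards with m k
      apply E_bound hq0 hq1
      rw [abs_neg, abs_of_nonneg (hn m)]
      exact hle m
  have l := l1.mul l2
  simp only [hinv, neg_zero, e0, E0, mul_one] at l
  exact tendsto_nhds_unique tendsto_const_nhds l

theorem hasSum_G {q : ℝ} (hq0 : 0 < q) (hq1 : q < 1) (c : ℕ → ℝ) (hc : ∀ k, 0 ≤ c k)
    (hsc : Summable c) {y : ℝ} (hy0 : 0 ≤ y) (hy : (1 - q) * y < 1)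
    {u : ℝ} (hu0 : 0 ≤ u) (hu1 : u ≤ 1) :
    HasSum (fun k => qAppell c q y k / qFact q k * u ^ k) (APow c u * qExp q (u * y)) := by
  have s1 : Summable fun k => c k * u ^ k :=
    Summable.of_nonneg_of_le (fun k => mul_nonneg (hc k) (pow_nonneg hu0 k))
      (fun k => mul_le_of_le_one_right (hc k) (pow_le_one₀ hu0 hu1)) hsc
  have huy : u * y ≤ y := mul_le_of_le_one_left hy0 hu1
  have s2 : Summable fun k => (u * y) ^ k / qFact q k :=
    summable_e hq0 hq1 (mul_nonneg hu0 hy0)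
      (lt_of_le_of_lt (mul_le_mul_of_nonneg_left huy (by linarith)) hy)
  have s1n := s1.norm
  have s2n := s2.norm
  have e := tsum_mul_tsum_eq_tsum_sum_range_of_summable_norm s1n s2n
  have s := (summable_norm_sum_mul_range_of_summable_norm s1n s2n).of_norm
  have hs := s.hasSum
  rw [← e] at hs
  unfold APow qExp
  refine Eq.mp (congrArg (fun f => HasSum f _) (funext fun k => ?_)) hs
  symm
  unfold qAppell
  rw [mul_div_cancel_left₀ _ (qFact_pos' hq0 hq1 k).ne', Finset.sum_mul]
  apply Finset.sum_congr rfl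
  intro j hj
  have : j ≤ k := by simpa [Nat.lt_succ_iff] using hj
  obtain ⟨i, rfl⟩ := Nat.exists_eq_add_of_le this
  rw [Nat.add_sub_cancel_left, pow_add, mul_pow]
  ring

/-- value of `T_{n,t}^{α,β}(e₂;q;x)`, with `y = [n]_q t`,
    `R = e_q^{qy} E_q^{-y}/A(1)` and `R' = e_q^{q²y} E_q^{-y}/A(1)`. -/
theorem stmt_5 (q : ℝ) (hq0 : 0 < q) (hq1 : q < 1)
    (c : ℕ → ℝ) (hc : ∀ k, 0 ≤ c k)
    (hrad : ∃ R : ℝ, 1 < R ∧ Summable fun k => c k * R ^ k) (hA1 : 0 < APow c 1)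
    (n : ℕ) (hn : 1 ≤ n) (t : ℝ) (ht0 : 0 ≤ t) (ht1 : (1 - q ^ n) * t < 1)
    (x : ℝ) (hx : 0 ≤ x) (α β : ℝ) (hα : 0 ≤ α) (hβ : 0 ≤ β)
    (y R R' : ℝ) (hy : y = qInt q n * t)
    (hR : R = qExp q (q * y) * qExpE q (-y) / APow c 1)
    (hR' : R' = qExp q (q ^ 2 * y) * qExpE q (-y) / APow c 1) :
    Tq c q n t α β (fun s => s ^ 2) x =
      x ^ 2 + 2 * x * (α + y + R * DqA1 c q) / (qInt q n + β)
        + (α ^ 2 + 2 * α * (y + R * DqA1 c q) + q * y ^ 2 + y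
            + 2 * q * y * R * DqA1 c q + (q * Dq2A1 c q + DqA1 c q) * R')
          / (qInt q n + β) ^ 2 := by
  obtain ⟨ρ, hρ, hsρ⟩ := hrad
  have hsc : Summable c := Summable.of_nonneg_of_le hc
    (fun k => le_mul_of_one_le_right (hc k) (one_le_pow₀ hρ.le)) hsρ
  have h1q : 0 < 1 - q := by linarith
  have hN : 0 < qInt q n := by
    obtain ⟨m, rfl⟩ := Nat.exists_eq_add_of_le hn
    rw [add_comm]
    exact qInt_pos' hq0 hq1 m
  have hy0 : 0 ≤ y := by rw [hy]; positivity
  have hy1 : (1 - q) * y < 1 := by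
    have : (1 - q) * y = (1 - q ^ n) * t := by
      rw [hy]; unfold qInt; field_simp
    rwa [this]
  have g0 := hasSum_G hq0 hq1 c hc hsc hy0 hy1 (u := 1) (by norm_num) le_rfl
  have g1 := hasSum_G hq0 hq1 c hc hsc hy0 hy1 (u := q) hq0.le hq1.le
  have g2 := hasSum_G hq0 hq1 c hc hsc hy0 hy1 (u := q ^ 2) (by positivity)
    (pow_le_one₀ hq0.le hq1.le)
  have hE := e_mul_E hq0 hq1 hy0 hy1
  have r1 := e_rec hq0 hq1 hy0 hy1
  have r2 := e_rec hq0 hq1 (mul_nonneg hq0.le hy0) (smaller hq0 hq1 hy0 hy1)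
  rw [← mul_assoc, ← pow_two, r1] at r2
  unfold Tq
  rw [← hy]
  have hD : 0 < qInt q n + β := by linarith
  generalize qInt q n + β = N at *
  -- the summand as a combination of `1, q^k, q^(2k)`
  have key := ((g0.mul_left ((x + (1 / (1 - q) + α) / N) ^ 2)).add
    (g1.mul_left (-(2 * (x + (1 / (1 - q) + α) / N) / ((1 - q) * N))))).add
    (g2.mul_left (1 / ((1 - q) * N) ^ 2))
  have hfun : (fun k : ℕ => qAppell c q y k / qFact q k *
      (fun s : ℝ => s ^ 2) (x + (qInt q k + α) / N)) =
      fun k : ℕ => (x + (1 / (1 - q) + α) / N) ^ 2 * (qAppell c q y k / qFact q k * 1 ^ k) +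
      (-(2 * (x + (1 / (1 - q) + α) / N) / ((1 - q) * N))) *
        (qAppell c q y k / qFact q k * q ^ k) +
      (1 / ((1 - q) * N) ^ 2) * (qAppell c q y k / qFact q k * (q ^ 2) ^ k) := by
    funext k
    have : (x + (qInt q k + α) / N) ^ 2 = (x + (1 / (1 - q) + α) / N) ^ 2 +
        (-(2 * (x + (1 / (1 - q) + α) / N) / ((1 - q) * N))) * q ^ k +
        (1 / ((1 - q) * N) ^ 2) * (q ^ 2) ^ k := by
      rw [← pow_mul, mul_comm 2 k, pow_mul]
      unfold qInt
      field_simp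
      ring
    simp only [this, one_pow]
    ring
  rw [hfun, key.tsum_eq]
  rw [r1] at hR
  rw [r2] at hR'
  rw [r1, r2, one_mul]
  have hEe : qExpE q (-y) = 1 / qExp q y := by
    have : qExp q y ≠ 0 := left_ne_zero_of_mul_eq_one hE
    field_simp
    linarith
  have hR2 : R = (1 - (1 - q) * y) / APow c 1 := by
    rw [hR]
    linear_combination ((1 - (1 - q) * y) / APow c 1) * hE
  have hR2' : R' = (1 - (1 - q) * y) * (1 - (1 - q) * (q * y)) / APow c 1 := by
    rw [hR']
    linear_combination ((1 - (1 - q) * y) * (1 - (1 - q) * (q * y)) / APow c 1) * hE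
  have he0 : qExp q y ≠ 0 := left_ne_zero_of_mul_eq_one hE
  rw [hR2, hR2', hEe]
  unfold Dq2A1 DqAq DqA1
  generalize qExp q y = e at *
  generalize APow c 1 = A0 at *
  generalize APow c q = A1 at *
  generalize APow c (q ^ 2) = A2 at *
  have hA0 := hA1.ne'
  have hq' := h1q.ne'
  have hN' := hD.ne'
  clear * - hA0 hq' hN' he0 hq0
  field_simp
  ring
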